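/- arXiv:1704.05782 — 3 statements merged into one kernel-verified Lean document; each statement's English description precedes it below -/
import Mathlib

section
/- Let A^(1),…,A^(K) be symmetric real n×n matrices and let p̲ ≤ p̄ in ℝ^K. Then A(p) = Σ_{k=1}^K p_k A^(k) is positive definite for every p with p̲ ≤ p ≤ p̄ (componentwise) if and only if A(p) is positive definite for every p such that p_k ∈ {p̲_k, p̄_k} for all k = 1,…,K. -/
theorem dotProduct_sum_smul_mulVec {ι n R : Type*} [Fintype ι] [Fintype n] [CommSemiring R]
    (A : ι → Matrix n n R) (p : ι → R) (x y : n → R) :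
    dotProduct y ((∑ k, p k • A k).mulVec x) = ∑ k, p k * dotProduct y ((A k).mulVec x) := by
  simp only [Matrix.sum_mulVec, dotProduct_sum, Matrix.smul_mulVec, dotProduct_smul, smul_eq_mul]

/-- Over a box, a linear function is minimised at a vertex. -/
theorem exists_vertex_sum_mul_le {ι : Type*} [Fintype ι] (c pl pu : ι → ℝ) :
    ∃ q : ι → ℝ, (∀ k, q k = pl k ∨ q k = pu k) ∧
      ∀ p, pl ≤ p → p ≤ pu → ∑ k, q k * c k ≤ ∑ k, p k * c k := by
  refine ⟨fun k => if 0 ≤ c k then pl k else pu k, fun k => ite_eq_or_eq _ _ _,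
    fun p hl hu => Finset.sum_le_sum fun k _ => ?_⟩
  dsimp only
  split_ifs with h
  · exact mul_le_mul_of_nonneg_right (hl k) h
  · exact mul_le_mul_of_nonpos_right (hu k) (not_le.mp h).le

theorem strong_pd_iff_vertices {n K : ℕ}
    (A : Fin K → Matrix (Fin n) (Fin n) ℝ) (hA : ∀ k, (A k).IsSymm)
    (pl pu : Fin K → ℝ) (hp : pl ≤ pu) :
    (∀ p : Fin K → ℝ, pl ≤ p → p ≤ pu → (∑ k, p k • A k).PosDef) ↔
    (∀ p : Fin K → ℝ, (∀ k, p k = pl k ∨ p k = pu k) →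
      (∑ k, p k • A k).PosDef) := by
  constructor
  · intro h p hv
    refine h p (fun k => ?_) (fun k => ?_) <;> rcases hv k with hk | hk <;> rw [hk]
    exacts [hp k, hp k]
  · intro h p hl hu
    refine Matrix.PosDef.of_dotProduct_mulVec_pos ?_ fun x hx => ?_
    · rw [Matrix.IsHermitian, Matrix.conjTranspose_eq_transpose_of_trivial, Matrix.transpose_sum]
      exact Finset.sum_congr rfl fun k _ => (hA k).smul (p k)
    · obtain ⟨q, hq, hle⟩ :=
        exists_vertex_sum_mul_le (fun k => dotProduct (star x) ((A k).mulVec x)) pl pu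
      have hpos := (h q hq).dotProduct_mulVec_pos hx
      rw [dotProduct_sum_smul_mulVec] at hpos ⊢
      exact hpos.trans_le (hle p hl hu)
end

section
/- Let A^(1),…,A^(K) be symmetric real n×n matrices and let p̲ ≤ p̄ in ℝ^K, with midpoint p_c = (p̲+p̄)/2 and radius p_Δ = (p̄−p̲)/2. Then A(p) = Σ_{k=1}^K p_k A^(k) is positive definite for every p in the box [p̲,p̄] if and only if for every nonzero x ∈ ℝ^n one has xᵀ A(p_c) x − Σ_{k=1}^K |xᵀ A^(k) x| · (p_Δ)_k > 0. -/
open Matrix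

theorem dotProduct_sum_smul_mulVec_s7 {n K : ℕ} (A : Fin K → Matrix (Fin n) (Fin n) ℝ)
    (p : Fin K → ℝ) (x : Fin n → ℝ) :
    x ⬝ᵥ ((∑ k, p k • A k) *ᵥ x) = ∑ k, p k * (x ⬝ᵥ (A k *ᵥ x)) := by
  simp [sum_mulVec, dotProduct_sum, smul_mulVec, dotProduct_smul]

theorem midpoint_mul_sub_abs_mul_radius_le {a b p q : ℝ} (ha : a ≤ p) (hb : p ≤ b) :
    (a + b) / 2 * q - |q| * ((b - a) / 2) ≤ p * q := by
  rcases abs_cases q with ⟨h, hq⟩ | ⟨h, hq⟩ <;> rw [h] <;> nlinarith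

theorem midpoint_mul_sub_abs_mul_radius_eq (a b q : ℝ) :
    (a + b) / 2 * q - |q| * ((b - a) / 2) = (if 0 ≤ q then a else b) * q := by
  split_ifs with h
  · rw [abs_of_nonneg h]; ring
  · rw [abs_of_neg (not_le.mp h)]; ring

theorem strong_pd_iff_quadratic_form {n K : ℕ}
    (A : Fin K → Matrix (Fin n) (Fin n) ℝ) (hA : ∀ k, (A k).IsSymm)
    (pl pu : Fin K → ℝ) (hp : pl ≤ pu) :
    (∀ p : Fin K → ℝ, pl ≤ p → p ≤ pu → (∑ k, p k • A k).PosDef) ↔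
    (∀ x : Fin n → ℝ, x ≠ 0 →
      x ⬝ᵥ ((∑ k, ((pl k + pu k) / 2) • A k) *ᵥ x) -
        ∑ k, |x ⬝ᵥ (A k *ᵥ x)| * ((pu k - pl k) / 2) > 0) := by
  constructor
  · intro h x hx
    let p : Fin K → ℝ := fun k => if 0 ≤ x ⬝ᵥ (A k *ᵥ x) then pl k else pu k
    have hpl : pl ≤ p := fun k => by
      dsimp only [p]; split_ifs
      exacts [le_rfl, hp k]
    have hpu : p ≤ pu := fun k => by
      dsimp only [p]; split_ifs
      exacts [hp k, le_rfl]
    have hpos := (h p hpl hpu).dotProduct_mulVec_pos hx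
    rw [star_trivial, dotProduct_sum_smul_mulVec_s7] at hpos
    rw [dotProduct_sum_smul_mulVec_s7 A (fun k => (pl k + pu k) / 2), ← Finset.sum_sub_distrib]
    simpa only [midpoint_mul_sub_abs_mul_radius_eq] using hpos
  · intro h p hpl hpu
    refine PosDef.of_dotProduct_mulVec_pos ?_ fun x hx => ?_
    · simp [IsHermitian, conjTranspose_eq_transpose_of_trivial, transpose_sum, (hA _).eq]
    · have hpos := h x hx
      rw [dotProduct_sum_smul_mulVec_s7 A (fun k => (pl k + pu k) / 2),
        ← Finset.sum_sub_distrib] at hpos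
      rw [star_trivial, dotProduct_sum_smul_mulVec_s7]
      exact hpos.trans_le <| Finset.sum_le_sum fun k _ =>
        midpoint_mul_sub_abs_mul_radius_le (hpl k) (hpu k)
end

section
/- Let A_c and A_Δ be symmetric real n×n matrices with A_Δ entrywise nonnegative. Then every symmetric matrix A satisfying |A − A_c| ≤ A_Δ entrywise is positive definite if and only if for every nonzero x ∈ ℝ^n one has xᵀ A_c x − |x|ᵀ A_Δ |x| > 0, where |x| denotes the vector of componentwise absolute values of x. -/
open Matrix

lemma Matrix.dotProduct_mulVec_eq_sum_sum {ι : Type*} [Fintype ι]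
    (A : Matrix ι ι ℝ) (x y : ι → ℝ) :
    x ⬝ᵥ (A *ᵥ y) = ∑ i, ∑ j, x i * A i j * y j := by
  simp [dotProduct, mulVec, Finset.mul_sum, mul_assoc]

/-- The quadratic form of a perturbation bounded entrywise by `D` is at least the worst-case one. -/
lemma Matrix.sub_abs_dotProduct_mulVec_abs_le {ι : Type*} [Fintype ι]
    {A B D : Matrix ι ι ℝ} (h : ∀ i j, |A i j - B i j| ≤ D i j) (x : ι → ℝ) :
    x ⬝ᵥ (B *ᵥ x) - (fun i => |x i|) ⬝ᵥ (D *ᵥ fun i => |x i|) ≤ x ⬝ᵥ (A *ᵥ x) := by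
  simp only [dotProduct_mulVec_eq_sum_sum, ← Finset.sum_sub_distrib]
  refine Finset.sum_le_sum fun i _ => Finset.sum_le_sum fun j _ => ?_
  have habs : |x i * (A i j - B i j) * x j| ≤ |x i| * D i j * |x j| := by
    rw [abs_mul, abs_mul]
    gcongr
    exact h i j
  linarith [neg_le_of_abs_le habs]

/-- The worst-case quadratic form at `x` is attained by a sign pattern taken from `x`. -/
lemma Matrix.dotProduct_mulVec_sub_sign {ι : Type*} [Fintype ι]
    (B D : Matrix ι ι ℝ) (x : ι → ℝ) :
    x ⬝ᵥ ((B - of fun i j =>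
        (SignType.sign (x i) : ℝ) * D i j * (SignType.sign (x j) : ℝ)) *ᵥ x) =
      x ⬝ᵥ (B *ᵥ x) - (fun i => |x i|) ⬝ᵥ (D *ᵥ fun i => |x i|) := by
  simp only [dotProduct_mulVec_eq_sum_sum, ← Finset.sum_sub_distrib]
  refine Finset.sum_congr rfl fun i _ => Finset.sum_congr rfl fun j _ => ?_
  rw [← self_mul_sign (x i), ← self_mul_sign (x j), Matrix.sub_apply, of_apply]
  ring

lemma abs_coe_sign_le_one (a : ℝ) : |(SignType.sign a : ℝ)| ≤ 1 := by
  cases SignType.sign a <;> simp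

theorem interval_pd_iff_quadratic_form {n : ℕ}
    (Ac AΔ : Matrix (Fin n) (Fin n) ℝ)
    (hAc : Ac.IsSymm) (hAΔ : AΔ.IsSymm) (hΔ : ∀ i j, 0 ≤ AΔ i j) :
    (∀ A : Matrix (Fin n) (Fin n) ℝ, A.IsSymm →
      (∀ i j, |A i j - Ac i j| ≤ AΔ i j) → A.PosDef) ↔
    (∀ x : Fin n → ℝ, x ≠ 0 →
      x ⬝ᵥ (Ac *ᵥ x) - (fun i => |x i|) ⬝ᵥ (AΔ *ᵥ fun i => |x i|) > 0) := by
  constructor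
  · intro h x hx
    rw [← dotProduct_mulVec_sub_sign]
    refine (h _ ?_ fun i j => ?_).dotProduct_mulVec_pos hx
    · refine IsSymm.ext fun i j => ?_
      simp only [Matrix.sub_apply, of_apply, hAc.apply i j, hAΔ.apply i j]
      ring
    · rw [Matrix.sub_apply, of_apply, sub_sub_cancel_left, abs_neg, abs_mul, abs_mul,
        abs_of_nonneg (hΔ i j)]
      calc _ ≤ 1 * AΔ i j * 1 := by
            gcongr
            · exact mul_nonneg zero_le_one (hΔ i j)
            · exact hΔ i j
            · exact abs_coe_sign_le_one _
            · exact abs_coe_sign_le_one _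
        _ = AΔ i j := by ring
  · intro h A hA hle
    refine .of_dotProduct_mulVec_pos ?_ fun x hx => ?_
    · rwa [IsHermitian, conjTranspose_eq_transpose_of_trivial]
    · rw [star_trivial]
      exact (h x hx).trans_le (sub_abs_dotProduct_mulVec_abs_le hle x)
end
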